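/- arXiv:2601.19718 — 3 statements merged into one kernel-verified Lean document; each statement's English description precedes it below -/
import Mathlib

section
/- Let D₁ and D₂ be disjoint nonempty finite sets with n₁ = |D₁|, n₂ = |D₂| and feature map φ into a real inner product space H. Write Φ₁ = Φ(D₁), Φ₂ = Φ(D₂), and Φ' = Φ(D₁ ∪ D₂). Then the decrease in total similarity caused by contracting D₁ and D₂ into D₁ ∪ D₂ satisfies the identity: Σ_{x∈D₁} ⟨φ(x), Φ₁⟩ + Σ_{x∈D₂} ⟨φ(x), Φ₂⟩ − Σ_{x∈D₁∪D₂} ⟨φ(x), Φ'⟩ = (n₂/(n₁+n₂)) · Σ_{x∈D₁} ⟨φ(x), Φ₁ − Φ₂⟩ + (n₁/(n₁+n₂)) · Σ_{x∈D₂} ⟨φ(x), Φ₂ − Φ₁⟩. -/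
open scoped RealInnerProductSpace

/-- Kernel mean map of a finite set `S` under feature map `φ`:
`Φ(S) = (1/|S|) • ∑ x ∈ S, φ x`. -/
noncomputable def kernelMeanMap {X H : Type*} [NormedAddCommGroup H]
    [InnerProductSpace ℝ H] (φ : X → H) (S : Finset X) : H :=
  (S.card : ℝ)⁻¹ • ∑ x ∈ S, φ x

/-- The decrease in total similarity caused by contracting two disjoint
clusters `D₁` and `D₂` into `D₁ ∪ D₂` satisfies the identity
`Σ_{x∈D₁}⟨φ(x),Φ₁⟩ + Σ_{x∈D₂}⟨φ(x),Φ₂⟩ − Σ_{x∈D₁∪D₂}⟨φ(x),Φ'⟩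
  = (n₂/(n₁+n₂))·Σ_{x∈D₁}⟨φ(x),Φ₁−Φ₂⟩ + (n₁/(n₁+n₂))·Σ_{x∈D₂}⟨φ(x),Φ₂−Φ₁⟩`. -/
theorem totalSimilarity_contract_decrease_eq {X H : Type*} [DecidableEq X]
    [NormedAddCommGroup H] [InnerProductSpace ℝ H] (φ : X → H)
    (D₁ D₂ : Finset X) (hdisj : Disjoint D₁ D₂)
    (h₁ : D₁.Nonempty) (h₂ : D₂.Nonempty) :
    ∑ x ∈ D₁, ⟪φ x, kernelMeanMap φ D₁⟫ +
        ∑ x ∈ D₂, ⟪φ x, kernelMeanMap φ D₂⟫ -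
        ∑ x ∈ D₁ ∪ D₂, ⟪φ x, kernelMeanMap φ (D₁ ∪ D₂)⟫ =
      ((D₂.card : ℝ) / ((D₁.card : ℝ) + (D₂.card : ℝ))) *
          ∑ x ∈ D₁, ⟪φ x, kernelMeanMap φ D₁ - kernelMeanMap φ D₂⟫ +
        ((D₁.card : ℝ) / ((D₁.card : ℝ) + (D₂.card : ℝ))) *
          ∑ x ∈ D₂, ⟪φ x, kernelMeanMap φ D₂ - kernelMeanMap φ D₁⟫ := by
  have p₁ : (0 : ℝ) < D₁.card := by exact_mod_cast h₁.card_pos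
  have p₂ : (0 : ℝ) < D₂.card := by exact_mod_cast h₂.card_pos
  have p₃ : (D₁.card : ℝ) + D₂.card ≠ 0 := by positivity
  simp only [← sum_inner]
  simp only [kernelMeanMap, Finset.sum_union hdisj,
    Finset.card_union_of_disjoint hdisj, inner_sub_right, inner_smul_right,
    inner_add_left, inner_add_right, Nat.cast_add]
  rw [real_inner_comm (∑ x ∈ D₁, φ x) (∑ x ∈ D₂, φ x)]
  field_simp
  ring
end

section
/- Let D₁ and D₂ be disjoint nonempty finite sets with n₁ = |D₁|, n₂ = |D₂| and feature map φ into a real inner product space H with ‖φ(x)‖ ≤ 1 for every x ∈ D₁ ∪ D₂. Write Φ₁ = Φ(D₁), Φ₂ = Φ(D₂), and Φ' = Φ(D₁ ∪ D₂). Then the absolute decrease in total similarity caused by contracting D₁ and D₂ is bounded by: |Σ_{x∈D₁} ⟨φ(x), Φ₁⟩ + Σ_{x∈D₂} ⟨φ(x), Φ₂⟩ − Σ_{x∈D₁∪D₂} ⟨φ(x), Φ'⟩| ≤ ((n₂·n₁ + n₁·n₂)/(n₁+n₂)) · ‖Φ₁ − Φ₂‖ = (2n₁n₂/(n₁+n₂))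 · ‖Φ₁ − Φ₂‖. -/
open scoped RealInnerProductSpace

/-- If all feature vectors have norm at most 1, the absolute decrease in total
similarity caused by contracting two disjoint clusters is bounded:
`|Σ_{x∈D₁}⟨φ(x),Φ₁⟩ + Σ_{x∈D₂}⟨φ(x),Φ₂⟩ − Σ_{x∈D₁∪D₂}⟨φ(x),Φ'⟩|
  ≤ ((n₂·n₁ + n₁·n₂)/(n₁+n₂))·‖Φ₁−Φ₂‖ = (2n₁n₂/(n₁+n₂))·‖Φ₁−Φ₂‖`. -/
theorem totalSimilarity_contract_decrease_bound {X H : Type*} [DecidableEq X]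
    [NormedAddCommGroup H] [InnerProductSpace ℝ H] (φ : X → H)
    (D₁ D₂ : Finset X) (hdisj : Disjoint D₁ D₂)
    (h₁ : D₁.Nonempty) (h₂ : D₂.Nonempty)
    (hφ : ∀ x ∈ D₁ ∪ D₂, ‖φ x‖ ≤ 1) :
    (|∑ x ∈ D₁, ⟪φ x, kernelMeanMap φ D₁⟫ +
        ∑ x ∈ D₂, ⟪φ x, kernelMeanMap φ D₂⟫ -
        ∑ x ∈ D₁ ∪ D₂, ⟪φ x, kernelMeanMap φ (D₁ ∪ D₂)⟫| ≤
      (((D₂.card : ℝ) * (D₁.card : ℝ) + (D₁.card : ℝ) * (D₂.card : ℝ)) /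
          ((D₁.card : ℝ) + (D₂.card : ℝ))) *
        ‖kernelMeanMap φ D₁ - kernelMeanMap φ D₂‖) ∧
    ((((D₂.card : ℝ) * (D₁.card : ℝ) + (D₁.card : ℝ) * (D₂.card : ℝ)) /
          ((D₁.card : ℝ) + (D₂.card : ℝ))) *
        ‖kernelMeanMap φ D₁ - kernelMeanMap φ D₂‖ =
      (2 * (D₁.card : ℝ) * (D₂.card : ℝ) / ((D₁.card : ℝ) + (D₂.card : ℝ))) *
        ‖kernelMeanMap φ D₁ - kernelMeanMap φ D₂‖) := by
  refine ⟨?_, by ring⟩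
  have hn₁ : (0 : ℝ) < D₁.card := by exact_mod_cast h₁.card_pos
  have hn₂ : (0 : ℝ) < D₂.card := by exact_mod_cast h₂.card_pos
  have key : ∀ S : Finset X, S.Nonempty →
      ∑ x ∈ S, φ x = (S.card : ℝ) • kernelMeanMap φ S := by
    intro S hS
    have : (S.card : ℝ) ≠ 0 := by exact_mod_cast hS.card_pos.ne'
    rw [kernelMeanMap, smul_smul, mul_inv_cancel₀ this, one_smul]
  have bd : ∀ S : Finset X, S.Nonempty → (∀ x ∈ S, ‖φ x‖ ≤ 1) →
      ‖kernelMeanMap φ S‖ ≤ 1 := by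
    intro S hS h
    have hc : (0 : ℝ) < S.card := by exact_mod_cast hS.card_pos
    have h3 : ‖∑ x ∈ S, φ x‖ ≤ S.card := by
      simpa using norm_sum_le_of_le S h
    rw [key S hS, norm_smul, Real.norm_of_nonneg hc.le] at h3
    nlinarith
  have b₁ := bd D₁ h₁ (fun x hx => hφ x (Finset.mem_union_left _ hx))
  have b₂ := bd D₂ h₂ (fun x hx => hφ x (Finset.mem_union_right _ hx))
  have hU : kernelMeanMap φ (D₁ ∪ D₂) = ((D₁.card : ℝ) + D₂.card)⁻¹ •
      ((D₁.card : ℝ) • kernelMeanMap φ D₁ + (D₂.card : ℝ) • kernelMeanMap φ D₂) := by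
    rw [← key D₁ h₁, ← key D₂ h₂, ← Finset.sum_union hdisj, kernelMeanMap,
      Finset.card_union_of_disjoint hdisj, Nat.cast_add]
  rw [← sum_inner, ← sum_inner, ← sum_inner, Finset.sum_union hdisj, hU, key D₁ h₁, key D₂ h₂]
  generalize kernelMeanMap φ D₁ = u at *
  generalize kernelMeanMap φ D₂ = v at *
  generalize (D₁.card : ℝ) = m at *
  generalize (D₂.card : ℝ) = n at *
  have hmn : 0 < m + n := by positivity
  have e : ⟪m • u, u⟫ + ⟪n • v, v⟫ - ⟪m • u + n • v, (m + n)⁻¹ • (m • u + n • v)⟫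
      = (m * n / (m + n)) * ‖u - v‖ ^ 2 := by
    rw [← real_inner_self_eq_norm_sq]
    simp only [inner_add_left, inner_add_right, inner_sub_left, inner_sub_right,
      real_inner_smul_left, real_inner_smul_right, real_inner_comm u v]
    field_simp
    ring
  have h2 : ‖u - v‖ ≤ 2 := (norm_sub_le u v).trans (by linarith)
  have hc : 0 ≤ m * n / (m + n) := by positivity
  rw [e, abs_of_nonneg (by positivity)]
  calc m * n / (m + n) * ‖u - v‖ ^ 2 = m * n / (m + n) * (‖u - v‖ * ‖u - v‖) := by ring
    _ ≤ m * n / (m + n) * (2 * ‖u - v‖) := by gcongr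
    _ = _ := by ring
end

section
/- (Lemma 1.) Let D be a nonempty finite set with feature map φ into a real inner product space H satisfying ‖φ(x)‖ ≤ 1 for every x ∈ D, and let D₁, D₂ ⊆ D be disjoint nonempty subsets. Let α > 0 be a real constant and assume ‖Φ(D₁) − Φ(D₂)‖ ≤ α. Then the normalized total similarity after contracting D₁ and D₂ into one cluster drops by at most α: (1/|D|) · Σ_{x∈D₁∪D₂} ⟨φ(x), Φ(D₁∪D₂)⟩ ≥ (1/|D|) · (Σ_{x∈D₁} ⟨φ(x), Φ(D₁)⟩ + Σ_{x∈D₂} ⟨φ(x), Φ(D₂)⟩) − α. -/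
open scoped RealInnerProductSpace

lemma card_smul_kernelMeanMap {X H : Type*} [NormedAddCommGroup H]
    [InnerProductSpace ℝ H] (φ : X → H) (S : Finset X) (h : S.Nonempty) :
    ∑ x ∈ S, φ x = (S.card : ℝ) • kernelMeanMap φ S := by
  have : (S.card : ℝ) ≠ 0 := by exact_mod_cast h.card_pos.ne'
  rw [kernelMeanMap, smul_smul, mul_inv_cancel₀ this, one_smul]

lemma norm_kernelMeanMap_le {X H : Type*} [NormedAddCommGroup H]
    [InnerProductSpace ℝ H] (φ : X → H) (S : Finset X) (h : S.Nonempty)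
    (hφ : ∀ x ∈ S, ‖φ x‖ ≤ 1) : ‖kernelMeanMap φ S‖ ≤ 1 := by
  have hc : (0 : ℝ) < S.card := by exact_mod_cast h.card_pos
  have h1 : ‖∑ x ∈ S, φ x‖ ≤ S.card := by
    refine (norm_sum_le _ _).trans ((Finset.sum_le_sum hφ).trans ?_)
    simp
  rw [card_smul_kernelMeanMap φ S h, norm_smul, Real.norm_of_nonneg hc.le] at h1
  nlinarith

/-- Lemma 1: if all feature vectors over `D` have norm at most 1 and the kernel
mean maps of two disjoint nonempty subsets `D₁, D₂ ⊆ D` are within distance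
`α`, then contracting them into one cluster drops the normalized total
similarity by at most `α`. -/
theorem contraction_drop_le_alpha {X H : Type*} [DecidableEq X]
    [NormedAddCommGroup H] [InnerProductSpace ℝ H] (φ : X → H)
    (D D₁ D₂ : Finset X) (hD : D.Nonempty)
    (hsub₁ : D₁ ⊆ D) (hsub₂ : D₂ ⊆ D) (hdisj : Disjoint D₁ D₂)
    (h₁ : D₁.Nonempty) (h₂ : D₂.Nonempty)
    (hφ : ∀ x ∈ D, ‖φ x‖ ≤ 1) (α : ℝ) (hα : 0 < α)
    (hclose : ‖kernelMeanMap φ D₁ - kernelMeanMap φ D₂‖ ≤ α) :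
    (D.card : ℝ)⁻¹ * ∑ x ∈ D₁ ∪ D₂, ⟪φ x, kernelMeanMap φ (D₁ ∪ D₂)⟫ ≥
      (D.card : ℝ)⁻¹ *
        (∑ x ∈ D₁, ⟪φ x, kernelMeanMap φ D₁⟫ +
          ∑ x ∈ D₂, ⟪φ x, kernelMeanMap φ D₂⟫) - α := by
  have ha : (0 : ℝ) < D₁.card := by exact_mod_cast h₁.card_pos
  have hb : (0 : ℝ) < D₂.card := by exact_mod_cast h₂.card_pos
  have hN : (0 : ℝ) < D.card := by exact_mod_cast hD.card_pos
  have hcard : ((D₁ ∪ D₂).card : ℝ) = D₁.card + D₂.card := by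
    rw [Finset.card_union_of_disjoint hdisj]; push_cast; rfl
  have hle : (D₁.card : ℝ) + D₂.card ≤ D.card := by
    rw [← hcard]; exact_mod_cast Finset.card_le_card (Finset.union_subset hsub₁ hsub₂)
  have n1 := norm_kernelMeanMap_le φ D₁ h₁ (fun x hx => hφ x (hsub₁ hx))
  have n2 := norm_kernelMeanMap_le φ D₂ h₂ (fun x hx => hφ x (hsub₂ hx))
  have hu : kernelMeanMap φ (D₁ ∪ D₂) = ((D₁.card : ℝ) + D₂.card)⁻¹ •
      ((D₁.card : ℝ) • kernelMeanMap φ D₁ + (D₂.card : ℝ) • kernelMeanMap φ D₂) := by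
    rw [← card_smul_kernelMeanMap φ D₁ h₁, ← card_smul_kernelMeanMap φ D₂ h₂,
      ← Finset.sum_union hdisj, ← hcard]
    rfl
  rw [← sum_inner, ← sum_inner, ← sum_inner, hu, Finset.sum_union hdisj,
    card_smul_kernelMeanMap φ D₁ h₁, card_smul_kernelMeanMap φ D₂ h₂]
  generalize kernelMeanMap φ D₁ = u at *
  generalize kernelMeanMap φ D₂ = v at *
  generalize (D₁.card : ℝ) = a at *
  generalize (D₂.card : ℝ) = b at *
  generalize (D.card : ℝ) = N at *
  have hd2 : ‖u - v‖ ≤ 2 := (norm_sub_le u v).trans (by linarith)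
  have hd : ‖u - v‖ ^ 2 ≤ 2 * α := by nlinarith [norm_nonneg (u - v)]
  have key : inner ℝ (a • u) u + inner ℝ (b • v) v
      - inner ℝ (a • u + b • v) ((a + b)⁻¹ • (a • u + b • v))
      = a * b / (a + b) * ‖u - v‖ ^ 2 := by
    rw [norm_sub_sq_real, ← real_inner_self_eq_norm_sq, ← real_inner_self_eq_norm_sq]
    simp only [inner_add_left, inner_add_right, real_inner_smul_left, real_inner_smul_right,
      real_inner_comm u v]
    field_simp
    ring
  have hab : a * b / (a + b) ≤ N / 4 := by
    rw [div_le_iff₀ (by positivity)]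
    nlinarith [sq_nonneg (a - b)]
  have h3 : a * b / (a + b) * ‖u - v‖ ^ 2 ≤ N * α := by
    have : a * b / (a + b) * ‖u - v‖ ^ 2 ≤ N / 4 * (2 * α) := by gcongr
    nlinarith [mul_pos hN hα]
  rw [← key] at h3
  have h4 := mul_le_mul_of_nonneg_left h3 (inv_nonneg.mpr hN.le)
  rw [← mul_assoc, inv_mul_cancel₀ hN.ne', one_mul, mul_sub] at h4
  linarith
end
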